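/- arXiv:2405.11226 — 4 statements merged into one kernel-verified Lean document; each statement's English description precedes it below -/
import Mathlib

section
/- Let μ(t) = 1/(1+exp(−t)) be the sigmoid function, ℓ(t,y) = y·log μ(t) + (1−y)·log(1−μ(t)) the log-likelihood, and κ(L) = sup_{|t|≤L} 1/μ'(t). For any real numbers L1, L2 with L1 ≥ max(L2, 1), any t, t* ∈ ℝ with |t| ≤ L1 and |t*| ≤ L2, and any y ∈ {0,1}, one has ℓ(t, y) ≤ ℓ(t*, y) + (y − μ(t*))·(t − t*) − (1/(20·L1·κ(L2)))·(t − t*)². -/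
/-- The sigmoid function μ(t) = 1/(1+exp(−t)). -/
noncomputable def mu (t : ℝ) : ℝ := 1 / (1 + Real.exp (-t))

/-- Its derivative μ'(t) = μ(t)(1−μ(t)). -/
noncomputable def mu' (t : ℝ) : ℝ := mu t * (1 - mu t)

/-- The log-likelihood ℓ(t,y) = y·log μ(t) + (1−y)·log(1−μ(t)). -/
noncomputable def logLik (t y : ℝ) : ℝ :=
  y * Real.log (mu t) + (1 - y) * Real.log (1 - mu t)

/-- κ(L) = sup_{|t|≤L} 1/μ'(t). -/
noncomputable def kappa (L : ℝ) : ℝ := sSup ((fun t => 1 / mu' t) '' {t : ℝ | |t| ≤ L})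

lemma mu_pos (t : ℝ) : 0 < mu t := by
  unfold mu; positivity

lemma one_sub_mu (t : ℝ) : 1 - mu t = mu (-t) := by
  have h : Real.exp (-t) * Real.exp t = 1 := by rw [← Real.exp_add]; simp
  have h1 := Real.exp_pos t
  have h2 := Real.exp_pos (-t)
  simp only [mu, neg_neg]
  field_simp
  linarith

lemma mu_eq_exp_div (t : ℝ) : mu t = Real.exp t / (1 + Real.exp t) := by
  have h : Real.exp (-t) * Real.exp t = 1 := by rw [← Real.exp_add]; simp
  have h1 := Real.exp_pos t
  have h2 := Real.exp_pos (-t)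
  unfold mu
  field_simp
  linarith

lemma mu'_pos (t : ℝ) : 0 < mu' t := by
  unfold mu'
  rw [one_sub_mu]
  exact mul_pos (mu_pos t) (mu_pos (-t))

lemma one_div_mu' (t : ℝ) : 1 / mu' t = 2 + Real.exp t + Real.exp (-t) := by
  have h : Real.exp (-t) * Real.exp t = 1 := by rw [← Real.exp_add]; simp
  have h1 := Real.exp_pos t
  have h2 := Real.exp_pos (-t)
  unfold mu'
  rw [one_sub_mu]
  simp only [mu, neg_neg]
  field_simp
  linarith

lemma one_div_mu'_le_kappa {L s : ℝ} (hs : |s| ≤ L) : 1 / mu' s ≤ kappa L := by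
  refine le_csSup ⟨2 + Real.exp L + Real.exp L, ?_⟩ ⟨s, hs, rfl⟩
  rintro _ ⟨u, hu, rfl⟩
  obtain ⟨h1, h2⟩ := abs_le.mp (show |u| ≤ L from hu)
  simp only [one_div_mu']
  have h3 := Real.exp_le_exp.mpr h2
  have h4 := Real.exp_le_exp.mpr (show -u ≤ L by linarith)
  linarith

lemma logLik_eq (t y : ℝ) : logLik t y = y * t - Real.log (1 + Real.exp t) := by
  have h1 := Real.exp_pos t
  have h2 : Real.log (1 - mu t) = -Real.log (1 + Real.exp t) := by
    rw [one_sub_mu]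
    simp [mu]
  have h3 : Real.log (mu t) = t - Real.log (1 + Real.exp t) := by
    rw [mu_eq_exp_div, Real.log_div h1.ne' (by positivity), Real.log_exp]
  rw [logLik, h2, h3]
  ring

lemma log_one_add_exp_eq (s t : ℝ) :
    Real.log (1 + Real.exp t) =
      Real.log (1 + Real.exp s) + Real.log (1 - mu s + mu s * Real.exp (t - s)) := by
  have h1 := Real.exp_pos s
  have h2 : 0 < 1 - mu s := by rw [one_sub_mu]; exact mu_pos _
  have h3 := mu_pos s
  rw [← Real.log_mul (by positivity) (by positivity)]
  congr 1
  rw [mu_eq_exp_div, Real.exp_sub]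
  field_simp
  ring

/-- Lower bound for the centred cumulant generating function of a Bernoulli variable. -/
lemma mul_exp_neg_sub_le_log_of_nonneg {m d : ℝ} (hm : 0 < m) (hm1 : m < 1) (hd : 0 ≤ d) :
    m * (1 - m) * (Real.exp (-d) - 1 + d) ≤ Real.log (1 - m + m * Real.exp d) - m * d := by
  have hpos (x : ℝ) : 0 < 1 - m + m * Real.exp x := by
    have := mul_pos hm (Real.exp_pos x)
    linarith
  let g : ℝ → ℝ := fun x =>
    Real.log (1 - m + m * Real.exp x) - m * x - m * (1 - m) * (Real.exp (-x) - 1 + x)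
  have hg (x : ℝ) : HasDerivAt g (m * Real.exp x / (1 - m + m * Real.exp x) - m
      - m * (1 - m) * (-Real.exp (-x) + 1)) x := by
    have h1 : HasDerivAt (fun x => 1 - m + m * Real.exp x) (m * Real.exp x) x :=
      ((Real.hasDerivAt_exp x).const_mul m).const_add _
    have h2 : HasDerivAt (fun x : ℝ => Real.exp (-x)) (-Real.exp (-x)) x := by
      simpa using (hasDerivAt_neg x).exp
    have h3 : HasDerivAt (fun x : ℝ => m * x) m x := by
      simpa using (hasDerivAt_id x).const_mul m
    exact ((h1.log (hpos x).ne').sub h3).sub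
      (((h2.sub_const 1).add (hasDerivAt_id x)).const_mul (m * (1 - m)))
  have hmono : MonotoneOn g (Set.Ici 0) := by
    refine monotoneOn_of_deriv_nonneg (convex_Ici 0)
      (fun x _ => (hg x).continuousAt.continuousWithinAt)
      (fun x _ => (hg x).differentiableAt.differentiableWithinAt) ?_
    intro x hx
    rw [interior_Ici] at hx
    rw [(hg x).deriv, Real.exp_neg]
    have h1 : 1 ≤ Real.exp x := Real.one_le_exp (le_of_lt hx)
    have h2 := hpos x
    have h3 : m * Real.exp x / (1 - m + m * Real.exp x) - m
        - m * (1 - m) * (-(Real.exp x)⁻¹ + 1) =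
        m * (1 - m) ^ 2 * (Real.exp x - 1) ^ 2 /
          ((1 - m + m * Real.exp x) * Real.exp x) := by
      field_simp
      ring
    rw [h3]
    positivity
  have h0 : g 0 = 0 := by simp [g]
  have h := hmono (Set.mem_Ici.mpr le_rfl) (Set.mem_Ici.mpr hd) hd
  rw [h0] at h
  simp only [g] at h
  linarith

lemma mul_exp_neg_abs_sub_le_log {m : ℝ} (d : ℝ) (hm : 0 < m) (hm1 : m < 1) :
    m * (1 - m) * (Real.exp (-|d|) - 1 + |d|) ≤
      Real.log (1 - m + m * Real.exp d) - m * d := by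
  rcases le_total 0 d with hd | hd
  · rw [abs_of_nonneg hd]
    exact mul_exp_neg_sub_le_log_of_nonneg hm hm1 hd
  · rw [abs_of_nonpos hd]
    have h := mul_exp_neg_sub_le_log_of_nonneg (m := 1 - m) (d := -d)
      (by linarith) (by linarith) (by linarith)
    have hpos : 0 < 1 - m + m * Real.exp d := by
      have := mul_pos hm (Real.exp_pos d)
      linarith
    have h1 : 1 - (1 - m) + (1 - m) * Real.exp (-d) =
        (1 - m + m * Real.exp d) / Real.exp d := by
      rw [Real.exp_neg]
      field_simp
      ring
    rw [h1, Real.log_div hpos.ne' (Real.exp_pos d).ne', Real.log_exp] at h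
    linarith

lemma sq_div_le_exp_neg_sub {x L : ℝ} (hx : 0 ≤ x) (hL : 1 ≤ L) (hxL : x ≤ 2 * L) :
    x ^ 2 / (20 * L) ≤ Real.exp (-x) - 1 + x := by
  rw [div_le_iff₀ (by positivity)]
  rcases le_total x 2 with h2 | h2
  · have h1 : (1 - x / 2) ^ 2 ≤ Real.exp (-x) := by
      have h3 : Real.exp (-x) = Real.exp (-(x / 2)) ^ 2 := by
        rw [← Real.exp_nat_mul]
        congr 1
        push_cast
        ring
      rw [h3]
      have h4 := Real.add_one_le_exp (-(x / 2))
      exact pow_le_pow_left₀ (by linarith) (by linarith) 2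
    have h5 : x ^ 2 / 4 ≤ Real.exp (-x) - 1 + x := by linarith
    have h6 := mul_le_mul_of_nonneg_right h5 (show 0 ≤ 20 * L by positivity)
    nlinarith [mul_nonneg (sq_nonneg x) (sub_nonneg.mpr hL), sq_nonneg x]
  · have h1 : x / 2 ≤ Real.exp (-x) - 1 + x := by linarith [Real.exp_pos (-x)]
    have h6 := mul_le_mul_of_nonneg_right h1 (show 0 ≤ 20 * L by positivity)
    nlinarith [mul_nonneg hx (sub_nonneg.mpr hxL)]

/-- Quadratic upper approximation of the log-likelihood. -/
theorem logLik_quadratic_upper_bound (L1 L2 t tstar y : ℝ)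
    (hL : max L2 1 ≤ L1) (ht : |t| ≤ L1) (htstar : |tstar| ≤ L2)
    (hy : y = 0 ∨ y = 1) :
    logLik t y ≤ logLik tstar y + (y - mu tstar) * (t - tstar)
      - (1 / (20 * L1 * kappa L2)) * (t - tstar) ^ 2 := by
  obtain ⟨hL2, hL1⟩ := max_le_iff.mp hL
  have hv := mu'_pos tstar
  have hk := one_div_mu'_le_kappa htstar
  have hk0 : 0 < kappa L2 := (one_div_pos.mpr hv).trans_le hk
  have hk' : 1 / kappa L2 ≤ mu' tstar := (one_div_le hv hk0).mp hk
  have hm1 : mu tstar < 1 := by linarith [one_sub_mu tstar, mu_pos (-tstar)]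
  have hlog := mul_exp_neg_abs_sub_le_log (t - tstar) (mu_pos tstar) hm1
  have hexp := sq_div_le_exp_neg_sub (abs_nonneg (t - tstar)) hL1
    (by linarith [abs_sub t tstar])
  rw [sq_abs] at hexp
  have hquad : 1 / (20 * L1 * kappa L2) * (t - tstar) ^ 2 ≤
      mu' tstar * (Real.exp (-|t - tstar|) - 1 + |t - tstar|) :=
    calc 1 / (20 * L1 * kappa L2) * (t - tstar) ^ 2
        = 1 / kappa L2 * ((t - tstar) ^ 2 / (20 * L1)) := by ring
      _ ≤ _ := mul_le_mul hk' hexp (by positivity) hv.le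
  rw [mu'] at hquad
  rw [logLik_eq, logLik_eq, log_one_add_exp_eq tstar t]
  linarith
end

section
/- Let ν̂, α ∈ ℝ^M with ‖ν̂‖₁ > 0, define α̂_m = |ν̂_m|/(2‖ν̂‖₁) + 1/(2M) for each m, and let ν̃ = ν̂ − α. Then Σ_{m=1}^M ν̃_m²/α̂_m ≤ 4‖ν̂‖₁² + 4M‖α‖₂². -/
/-- With Active-Sample proportions α̂_m = |ν̂_m|/(2‖ν̂‖₁) + 1/(2M) and ν̃ = ν̂ − α,
one has Σ ν̃_m²/α̂_m ≤ 4‖ν̂‖₁² + 4M‖α‖₂². -/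
theorem weighted_sum_sq_bound {M : ℕ} (νhat α : Fin M → ℝ)
    (h : 0 < ∑ m, |νhat m|) (αhat : Fin M → ℝ)
    (hαhat : ∀ m, αhat m = |νhat m| / (2 * ∑ m', |νhat m'|) + 1 / (2 * M))
    (νtil : Fin M → ℝ) (hν : νtil = νhat - α) :
    ∑ m, (νtil m) ^ 2 / αhat m ≤
      4 * (∑ m, |νhat m|) ^ 2 + 4 * M * ∑ m, (α m) ^ 2 := by
  subst hν
  set S := ∑ m, |νhat m| with hS
  have termwise : ∀ m, (νhat m - α m) ^ 2 / αhat m ≤ 4 * S * |νhat m| + 4 * M * α m ^ 2 := by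
    intro m
    have hM : (0 : ℝ) < M := by exact_mod_cast m.pos
    have hv := abs_nonneg (νhat m)
    rw [hαhat m, div_le_iff₀ (by positivity)]
    have expand : (4 * S * |νhat m| + 4 * M * α m ^ 2) * (|νhat m| / (2 * S) + 1 / (2 * M)) =
        2 * |νhat m| ^ 2 + 2 * α m ^ 2 + (2 * S * |νhat m| / M + 2 * M * α m ^ 2 * |νhat m| / S) := by
      field_simp
      ring
    have cross : 0 ≤ 2 * S * |νhat m| / M + 2 * M * α m ^ 2 * |νhat m| / S := by positivity
    rw [expand, sq_abs]
    nlinarith [sq_nonneg (νhat m + α m)]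
  calc ∑ m, (νhat - α) m ^ 2 / αhat m
      ≤ ∑ m, (4 * S * |νhat m| + 4 * M * α m ^ 2) := Finset.sum_le_sum fun m _ => termwise m
    _ = 4 * S ^ 2 + 4 * M * ∑ m, α m ^ 2 := by
      rw [Finset.sum_add_distrib, ← Finset.mul_sum, ← Finset.mul_sum, ← hS]
      ring
end

section
/- Let Λ be a positive definite d×d real matrix with norm ‖x‖_Λ = √(xᵀΛx), let r > 0, θ̂ ∈ ℝ^d, and define the confidence set C = {θ ∈ ℝ^d : ‖θ − θ̂‖_Λ ≤ r}. Suppose θ* ∈ C, and suppose u, u* ∈ ℝ^d satisfy the pessimistic-optimality condition inf_{θ∈C} ⟨u, θ⟩ ≥ inf_{θ∈C} ⟨u*, θ⟩. Then ⟨u*, θ*⟩ − ⟨u, θ*⟩ ≤ 2r·‖u*‖_{Λ⁻¹}, where ‖u‖_{Λ⁻¹} = √(uᵀΛ⁻¹u). -/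
open Matrix

/-- Mahalanobis norm ‖x‖_A = √(xᵀ A x) associated with a positive definite matrix A. -/
noncomputable def mnorm {d : ℕ} (A : Matrix (Fin d) (Fin d) ℝ) (x : Fin d → ℝ) : ℝ :=
  Real.sqrt (x ⬝ᵥ A.mulVec x)

/-- Weighted Cauchy–Schwarz inequality: the norms of `A⁻¹` and `A` are dual to each other. -/
theorem abs_dotProduct_le_mnorm_inv_mul_mnorm {d : ℕ} {A : Matrix (Fin d) (Fin d) ℝ}
    (hA : A.PosDef) (v w : Fin d → ℝ) : |v ⬝ᵥ w| ≤ mnorm A⁻¹ v * mnorm A w := by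
  have hdet : IsUnit A.det := (Matrix.isUnit_iff_isUnit_det A).mp hA.isUnit
  have hAv : A *ᵥ (A⁻¹ *ᵥ v) = v := by
    rw [mulVec_mulVec, mul_nonsing_inv A hdet, one_mulVec]
  have hT : Aᵀ = A := by simpa using hA.isHermitian.eq
  have hcross : (A⁻¹ *ᵥ v) ⬝ᵥ (A *ᵥ w) = v ⬝ᵥ w := by
    rw [dotProduct_mulVec, ← mulVec_transpose, hT, hAv]
  have hv : 0 ≤ v ⬝ᵥ A⁻¹ *ᵥ v := by
    simpa using hA.inv.posSemidef.dotProduct_mulVec_nonneg v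
  have hquad (t : ℝ) :
      0 ≤ (v ⬝ᵥ A⁻¹ *ᵥ v) * (t * t) + (2 * (v ⬝ᵥ w)) * t + w ⬝ᵥ A *ᵥ w := by
    have h := hA.posSemidef.dotProduct_mulVec_nonneg (w + t • (A⁻¹ *ᵥ v))
    simp only [star_trivial, mulVec_add, mulVec_smul, hAv, add_dotProduct, dotProduct_add,
      smul_dotProduct, dotProduct_smul, smul_eq_mul, hcross] at h
    rw [dotProduct_comm w v, dotProduct_comm (A⁻¹ *ᵥ v) v] at h
    linarith
  have hdiscrim := discrim_le_zero hquad
  rw [mnorm, mnorm, ← Real.sqrt_mul hv]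
  apply Real.abs_le_sqrt
  rw [discrim] at hdiscrim
  linarith

/-- A linear functional deviates from its value at the centre of an ellipsoid of radius `r`
by at most `r` times its dual norm. -/
theorem abs_dotProduct_sub_le_of_mnorm_le {d : ℕ} {A : Matrix (Fin d) (Fin d) ℝ}
    (hA : A.PosDef) {r : ℝ} {x c : Fin d → ℝ} (hx : mnorm A (x - c) ≤ r) (v : Fin d → ℝ) :
    |v ⬝ᵥ x - v ⬝ᵥ c| ≤ r * mnorm A⁻¹ v := by
  rw [← dotProduct_sub, mul_comm]
  exact (abs_dotProduct_le_mnorm_inv_mul_mnorm hA v _).trans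
    (mul_le_mul_of_nonneg_left hx (Real.sqrt_nonneg _))

/-- Suboptimality bound for the pessimistic policy: if θ* lies in the confidence
ellipsoid C = {θ : ‖θ − θ̂‖_Λ ≤ r} and inf_{θ∈C}⟨u,θ⟩ ≥ inf_{θ∈C}⟨u*,θ⟩, then
⟨u*,θ*⟩ − ⟨u,θ*⟩ ≤ 2r‖u*‖_{Λ⁻¹}. -/
theorem pessimism_suboptimality_bound {d : ℕ}
    (Λ : Matrix (Fin d) (Fin d) ℝ) (hΛ : Λ.PosDef) (r : ℝ) (hr : 0 < r)
    (θhat θstar u ustar : Fin d → ℝ)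
    (hθstar : mnorm Λ (θstar - θhat) ≤ r)
    (hpess : sInf {z : ℝ | ∃ θ : Fin d → ℝ, mnorm Λ (θ - θhat) ≤ r ∧ z = ustar ⬝ᵥ θ} ≤
             sInf {z : ℝ | ∃ θ : Fin d → ℝ, mnorm Λ (θ - θhat) ≤ r ∧ z = u ⬝ᵥ θ}) :
    ustar ⬝ᵥ θstar - u ⬝ᵥ θstar ≤ 2 * r * Real.sqrt (ustar ⬝ᵥ Λ⁻¹.mulVec ustar) := by
  have hlower (v θ : Fin d → ℝ) (hθ : mnorm Λ (θ - θhat) ≤ r) :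
      v ⬝ᵥ θhat - r * mnorm Λ⁻¹ v ≤ v ⬝ᵥ θ := by
    linarith [(abs_le.mp (abs_dotProduct_sub_le_of_mnorm_le hΛ hθ v)).1]
  have hu : sInf {z : ℝ | ∃ θ : Fin d → ℝ, mnorm Λ (θ - θhat) ≤ r ∧ z = u ⬝ᵥ θ} ≤
      u ⬝ᵥ θstar := by
    refine csInf_le ⟨u ⬝ᵥ θhat - r * mnorm Λ⁻¹ u, ?_⟩ ⟨θstar, hθstar, rfl⟩
    rintro _ ⟨θ, hθ, rfl⟩
    exact hlower u θ hθ
  have hustar : ustar ⬝ᵥ θhat - r * mnorm Λ⁻¹ ustar ≤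
      sInf {z : ℝ | ∃ θ : Fin d → ℝ, mnorm Λ (θ - θhat) ≤ r ∧ z = ustar ⬝ᵥ θ} := by
    refine le_csInf ⟨_, θstar, hθstar, rfl⟩ ?_
    rintro _ ⟨θ, hθ, rfl⟩
    exact hlower ustar θ hθ
  have hupper := (abs_le.mp (abs_dotProduct_sub_le_of_mnorm_le hΛ hθstar ustar)).2
  change _ ≤ 2 * r * mnorm Λ⁻¹ ustar
  linarith
end

section
/- Let μ(t) = 1/(1+exp(−t)) be the sigmoid function. Let x_1, …, x_n ∈ ℝ^d, θ̂, θ* ∈ ℝ^d, λ ≥ 0, and suppose |x_iᵀθ̂ − x_iᵀθ*| ≤ 1 for all i. Define Ĥ = Σ_i μ'(x_iᵀθ*)·x_i x_iᵀ + nλ·I. Then 0.3·Ĥ ⪯ Σ_i μ'(x_iᵀθ̂)·x_i x_iᵀ + nλ·I ⪯ 3·Ĥ in the positive semidefinite order. -/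
open Matrix

theorem mu'_eq (t : ℝ) : mu' t = Real.exp (-t) / (1 + Real.exp (-t)) ^ 2 := by
  have := Real.exp_pos (-t)
  unfold mu' mu
  field_simp
  ring

theorem mu'_nonneg (t : ℝ) : 0 ≤ mu' t := by
  rw [mu'_eq]
  positivity

theorem exp_neg_le_three_mul_exp_neg {s t : ℝ} (h : |s - t| ≤ 1) :
    Real.exp (-s) ≤ 3 * Real.exp (-t) := by
  have h₁ : Real.exp (-s) ≤ Real.exp (1 + -t) :=
    Real.exp_le_exp.2 (by linarith [(abs_le.1 h).1])
  rw [Real.exp_add] at h₁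
  nlinarith [Real.exp_pos (-t), Real.exp_one_lt_d9]

theorem mu'_le_three_mul {s t : ℝ} (h : |s - t| ≤ 1) : mu' s ≤ 3 * mu' t := by
  have hst := exp_neg_le_three_mul_exp_neg h
  have hts := exp_neg_le_three_mul_exp_neg (abs_sub_comm s t ▸ h)
  have hs := Real.exp_pos (-s)
  have ht := Real.exp_pos (-t)
  rw [mu'_eq, mu'_eq, ← mul_div_assoc, div_le_div_iff₀ (by positivity) (by positivity)]
  nlinarith [mul_pos hs ht, mul_le_mul_of_nonneg_left hts (mul_pos hs ht).le]

theorem posSemidef_sum_smul_vecMulVec_add_smul_one {ι m : Type*} [Fintype ι] [Fintype m]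
    [DecidableEq m] (x : ι → m → ℝ) {c : ι → ℝ} {k : ℝ} (hc : ∀ i, 0 ≤ c i) (hk : 0 ≤ k) :
    ((∑ i, c i • vecMulVec (x i) (x i)) + k • (1 : Matrix m m ℝ)).PosSemidef := by
  refine (posSemidef_sum _ fun i _ ↦ ?_).add (PosSemidef.one.smul hk)
  have h := posSemidef_vecMulVec_self_star (x i)
  rw [star_trivial] at h
  exact h.smul (hc i)

/-- If |x_iᵀθ̂ − x_iᵀθ*| ≤ 1 for all i, then the regularized Hessian at θ̂ is
sandwiched between 0.3 and 3 times the regularized Hessian at θ*. -/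
theorem hessian_sandwich {d n : ℕ} (x : Fin n → Fin d → ℝ)
    (θhat θstar : Fin d → ℝ) (lam : ℝ) (hlam : 0 ≤ lam)
    (hclose : ∀ i, |x i ⬝ᵥ θhat - x i ⬝ᵥ θstar| ≤ 1)
    (Hhat A : Matrix (Fin d) (Fin d) ℝ)
    (hHhat : Hhat = (∑ i, mu' (x i ⬝ᵥ θstar) • vecMulVec (x i) (x i)) +
      ((n : ℝ) * lam) • (1 : Matrix (Fin d) (Fin d) ℝ))
    (hA : A = (∑ i, mu' (x i ⬝ᵥ θhat) • vecMulVec (x i) (x i)) +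
      ((n : ℝ) * lam) • (1 : Matrix (Fin d) (Fin d) ℝ)) :
    (A - (0.3 : ℝ) • Hhat).PosSemidef ∧ ((3 : ℝ) • Hhat - A).PosSemidef := by
  subst hHhat hA
  have hk : 0 ≤ (n : ℝ) * lam := by positivity
  constructor
  · convert posSemidef_sum_smul_vecMulVec_add_smul_one x
      (c := fun i ↦ mu' (x i ⬝ᵥ θhat) - 0.3 * mu' (x i ⬝ᵥ θstar))
      (k := 0.7 * ((n : ℝ) * lam)) (fun i ↦ ?_) (by positivity) using 1
    · simp only [sub_smul, mul_smul, Finset.sum_sub_distrib, ← Finset.smul_sum]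
      module
    · have h := mu'_le_three_mul (abs_sub_comm (x i ⬝ᵥ θhat) (x i ⬝ᵥ θstar) ▸ hclose i)
      linarith [mu'_nonneg (x i ⬝ᵥ θstar)]
  · convert posSemidef_sum_smul_vecMulVec_add_smul_one x
      (c := fun i ↦ 3 * mu' (x i ⬝ᵥ θstar) - mu' (x i ⬝ᵥ θhat))
      (k := 2 * ((n : ℝ) * lam)) (fun i ↦ ?_) (by positivity) using 1
    · simp only [sub_smul, mul_smul, Finset.sum_sub_distrib, ← Finset.smul_sum]
      module
    · exact sub_nonneg.2 (mu'_le_three_mul (hclose i))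
end
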